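/- Suppose every buyer has ρ_i ∈ (−∞,0) ∪ (0,1) (no linear, Leontief, or Cobb-Douglas utilities) and all buyers update by the Damped Proportional Response rule starting from an entrywise positive feasible b^0. Let σ_{>0} = min_{i: ρ_i>0} (1 − ρ_i), σ_{<0} = min_{i: ρ_i<0} 1/(1 − ρ_i), and let (b*_{>0}, b*_{<0}) be the saddle point of Φ. Then for all T ≥ 1: Φ(b^T_{>0}, b*_{<0}) − Φ(b*_{>0}, b^T_{<0}) ≤ ( 1 − min{σ_{>0}, σ_{<0}}/2 )^{T−1} · [ Σ_{i: ρ_i<0} (2−σ_{<0})·((ρ_i−1)/ρ_i)·KL(b_i* ‖ b_i^0) + Σ_{i: ρ_i>0} (2−σ_{>0})·(1/ρ_i)·KL(b_i* ‖ b_i^0) ]. -/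

import Mathlib

open Finset

/-- Price of good `j` given spending `b`. -/
noncomputable def price {m n : ℕ} (b : Fin m → Fin n → ℝ) (j : Fin n) : ℝ :=
  ∑ i, b i j

/-- KL divergence between two nonnegative vectors. -/
noncomputable def KL {n : ℕ} (x y : Fin n → ℝ) : ℝ :=
  ∑ j, x j * Real.log (x j / y j)

/-- Feasible spending: nonnegative entries, each buyer spends exactly her budget. -/
def Feasible {m n : ℕ} (e : Fin m → ℝ) (b : Fin m → Fin n → ℝ) : Prop :=
  ∀ i, (∀ j, 0 ≤ b i j) ∧ ∑ j, b i j = e i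

/-- The potential function `Φ` for CES substitutes buyers. -/
noncomputable def Phi {m n : ℕ} (a : Fin m → Fin n → ℝ) (ρ : Fin m → ℝ)
    (b : Fin m → Fin n → ℝ) : ℝ :=
  -∑ i, (1 / ρ i) * ∑ j, b i j * Real.log (a i j * b i j ^ (ρ i - 1) / price b j ^ ρ i)


/-- `mix S b b'` takes buyer `i`'s spending from `b` when `i ∈ S`, else from `b'`. -/
def mix {m n : ℕ} (S : Finset (Fin m)) (b b' : Fin m → Fin n → ℝ) :
    Fin m → Fin n → ℝ :=
  fun i => if i ∈ S then b i else b' i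

theorem mul_log_div_ge {s t c : ℝ} (hs : 0 ≤ s) (ht : 0 < t) (hc : 0 < c) :
    s * Real.log c + s - t * c ≤ s * Real.log (s / t) := by
  rcases hs.eq_or_lt with rfl | hs
  · simpa using (mul_pos ht hc).le
  · have h := Real.log_le_sub_one_of_pos (x := t * c / s) (by positivity)
    rw [Real.log_div (by positivity) hs.ne', Real.log_mul ht.ne' hc.ne'] at h
    rw [Real.log_div hs.ne' ht.ne']
    have h2 := mul_le_mul_of_nonneg_left h hs.le
    have h3 : s * (t * c / s - 1) = t * c - s := by field_simp
    nlinarith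

theorem log_sum_inequality {ι : Type*} (I : Finset ι) {s t : ι → ℝ} (hs : ∀ i, 0 ≤ s i)
    (ht : ∀ i, 0 < t i) :
    (∑ i ∈ I, s i) * Real.log ((∑ i ∈ I, s i) / ∑ i ∈ I, t i) ≤
      ∑ i ∈ I, s i * Real.log (s i / t i) := by
  rcases (Finset.sum_nonneg fun i (_ : i ∈ I) => hs i).eq_or_lt with h | h
  · have h0 := (Finset.sum_eq_zero_iff_of_nonneg fun i _ => hs i).1 h.symm
    rw [← h, zero_mul]
    exact (Finset.sum_eq_zero fun i hi => by rw [h0 i hi, zero_mul]).ge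
  · have hI : I.Nonempty := by
      by_contra hI
      simp [Finset.not_nonempty_iff_eq_empty.1 hI] at h
    have hT : 0 < ∑ i ∈ I, t i := Finset.sum_pos (fun i _ => ht i) hI
    have key := Finset.sum_le_sum fun i (_ : i ∈ I) =>
      mul_log_div_ge (hs i) (ht i) (div_pos h hT)
    rw [Finset.sum_sub_distrib, Finset.sum_add_distrib, ← Finset.sum_mul, ← Finset.sum_mul,
      mul_div_cancel₀ _ hT.ne'] at key
    linarith

theorem KL_nonneg {n : ℕ} {x y : Fin n → ℝ} (hx : ∀ j, 0 ≤ x j) (hy : ∀ j, 0 < y j)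
    (hxy : ∑ j, x j = ∑ j, y j) : 0 ≤ KL x y := by
  have key := Finset.sum_le_sum fun j (_ : j ∈ Finset.univ) =>
    mul_log_div_ge (hx j) (hy j) one_pos
  simp only [Real.log_one, mul_zero, zero_add, mul_one, Finset.sum_sub_distrib] at key
  unfold KL
  linarith

theorem sum_price {m n : ℕ} {e : Fin m → ℝ} {b : Fin m → Fin n → ℝ} (hb : Feasible e b) :
    ∑ j, price b j = ∑ i, e i := by
  unfold price
  rw [Finset.sum_comm]
  exact Finset.sum_congr rfl fun i _ => (hb i).2

theorem price_pos {m n : ℕ} {b : Fin m → Fin n → ℝ} (hb : ∀ i j, 0 < b i j) (i : Fin m)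
    (j : Fin n) : 0 < price b j :=
  Finset.sum_pos (fun i _ => hb i j) ⟨i, Finset.mem_univ i⟩

theorem KL_price_le {m n : ℕ} {z y : Fin m → Fin n → ℝ} (hz : ∀ i j, 0 ≤ z i j)
    (hy : ∀ i j, 0 < y i j) : KL (price z) (price y) ≤ ∑ i, KL (z i) (y i) := by
  unfold KL price
  rw [Finset.sum_comm]
  exact Finset.sum_le_sum fun j _ =>
    log_sum_inequality Finset.univ (fun i => hz i j) (fun i => hy i j)

theorem mix_feasible {m n : ℕ} {e : Fin m → ℝ} {b b' : Fin m → Fin n → ℝ} (P : Finset (Fin m))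
    (hb : Feasible e b) (hb' : Feasible e b') : Feasible e (mix P b b') := by
  intro i
  unfold mix
  split_ifs
  exacts [hb i, hb' i]

/-- The partial derivative of `Φ` in `b i j`, up to an additive constant depending on `i`. -/
noncomputable def gradPhi {m n : ℕ} (a : Fin m → Fin n → ℝ) (ρ : Fin m → ℝ)
    (y : Fin m → Fin n → ℝ) (i : Fin m) (j : Fin n) : ℝ :=
  -(1 / ρ i) * Real.log (a i j) + (1 - ρ i) / ρ i * Real.log (y i j) + Real.log (price y j)

/-- Bregman expansion of `Φ` around a positive spending matrix `y`. -/
theorem Phi_eq {m n : ℕ} {a : Fin m → Fin n → ℝ} {ρ : Fin m → ℝ} (ha : ∀ i j, 0 < a i j)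
    (hρ : ∀ i, ρ i ≠ 0) {z y : Fin m → Fin n → ℝ} (hz : ∀ i j, 0 ≤ z i j)
    (hy : ∀ i j, 0 < y i j) :
    Phi a ρ z = ∑ i, (∑ j, z i j * gradPhi a ρ y i j + (1 - ρ i) / ρ i * KL (z i) (y i)) +
      KL (price z) (price y) := by
  have hprice : KL (price z) (price y) =
      ∑ i, ∑ j, z i j * Real.log (price z j / price y j) := by
    rw [Finset.sum_comm]
    exact Finset.sum_congr rfl fun j _ => by rw [← Finset.sum_mul]; rfl
  rw [hprice, ← Finset.sum_add_distrib]
  unfold Phi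
  rw [← Finset.sum_neg_distrib]
  refine Finset.sum_congr rfl fun i _ => ?_
  unfold KL
  rw [Finset.mul_sum, Finset.mul_sum, ← Finset.sum_neg_distrib, ← Finset.sum_add_distrib,
    ← Finset.sum_add_distrib]
  refine Finset.sum_congr rfl fun j _ => ?_
  rcases (hz i j).eq_or_lt with h | h
  · simp [← h]
  · have hp : 0 < price z j :=
      h.trans_le (Finset.single_le_sum (f := fun i => z i j) (fun i _ => hz i j)
        (Finset.mem_univ i))
    have hpy := price_pos hy i j
    have hr := hρ i
    rw [Real.log_div (by have := ha i j; positivity) (by positivity),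
      Real.log_mul (ha i j).ne' (by positivity), Real.log_rpow h, Real.log_rpow hp,
      Real.log_div h.ne' (hy i j).ne', Real.log_div hp.ne' hpy.ne']
    unfold gradPhi
    field_simp
    ring

theorem KL_three_point {n : ℕ} {s x y : Fin n → ℝ} (hs : ∀ j, 0 ≤ s j) (hx : ∀ j, 0 < x j)
    (hy : ∀ j, 0 < y j) :
    ∑ j, (x j - s j) * (Real.log (y j) - Real.log (x j)) = KL s y - KL s x - KL x y := by
  unfold KL
  rw [← Finset.sum_sub_distrib, ← Finset.sum_sub_distrib]
  refine Finset.sum_congr rfl fun j _ => ?_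
  rw [Real.log_div (hx j).ne' (hy j).ne']
  rcases (hs j).eq_or_lt with h | h
  · rw [← h]
    ring
  · rw [Real.log_div h.ne' (hy j).ne', Real.log_div h.ne' (hx j).ne']
    ring

theorem mirror_step_inner {n : ℕ} {s x y g : Fin n → ℝ} {w C : ℝ} (hs : ∀ j, 0 ≤ s j)
    (hx : ∀ j, 0 < x j) (hy : ∀ j, 0 < y j) (hsx : ∑ j, s j = ∑ j, x j)
    (hg : ∀ j, g j = 2 * w * (Real.log (y j) - Real.log (x j)) + C) :
    ∑ j, x j * g j - ∑ j, s j * g j = 2 * w * (KL s y - KL s x - KL x y) := by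
  rw [← KL_three_point hs hx hy, Finset.mul_sum, ← Finset.sum_sub_distrib]
  have : ∑ j, (x j - s j) * C = 0 := by
    rw [← Finset.sum_mul, Finset.sum_sub_distrib, hsx, sub_self, zero_mul]
  rw [← add_zero (∑ j, 2 * w * _), ← this, ← Finset.sum_add_distrib]
  exact Finset.sum_congr rfl fun j _ => by rw [hg j]; ring

/-- One simultaneous mirror descent-ascent step with Bregman weights `2 * w i`. -/
theorem mirror_step_gap_le {m n : ℕ} (P : Finset (Fin m)) {e : Fin m → ℝ}
    {a : Fin m → Fin n → ℝ} (ha : ∀ i j, 0 < a i j) {ρ : Fin m → ℝ} (hρ : ∀ i, ρ i ≠ 0)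
    {w σ : Fin m → ℝ} (hwP : ∀ i ∈ P, w i = 1 / ρ i) (hwN : ∀ i ∉ P, w i = (ρ i - 1) / ρ i)
    (hw : ∀ i, 0 < w i) (hσ : ∀ i, 1 ≤ (1 - σ i) * w i) {x y s : Fin m → Fin n → ℝ}
    (hxpos : ∀ i j, 0 < x i j) (hypos : ∀ i j, 0 < y i j) (hx : Feasible e x)
    (hy : Feasible e y) (hs : Feasible e s)
    (hstepP : ∀ i ∈ P, ∃ C, ∀ j,
      gradPhi a ρ y i j = 2 * w i * (Real.log (y i j) - Real.log (x i j)) + C)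
    (hstepN : ∀ i ∉ P, ∃ C, ∀ j,
      -gradPhi a ρ y i j = 2 * w i * (Real.log (y i j) - Real.log (x i j)) + C) :
    Phi a ρ (mix P x s) - Phi a ρ (mix P s x) ≤
      ∑ i, (2 - σ i) * w i * KL (s i) (y i) - 2 * ∑ i, w i * KL (s i) (x i) := by
  have hz := mix_feasible P hx hs
  have hz' := mix_feasible P hs hx
  rw [Phi_eq ha hρ (fun i => (hz i).1) hypos, Phi_eq ha hρ (fun i => (hz' i).1) hypos]
  have h1 := KL_price_le (fun i => (hz i).1) hypos
  have h2 : 0 ≤ KL (price (mix P s x)) (price y) := by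
    rcases isEmpty_or_nonempty (Fin m) with hm | ⟨⟨i⟩⟩
    · simp [KL, price]
    · exact KL_nonneg (fun j => Finset.sum_nonneg fun i _ => (hz' i).1 j)
        (fun j => price_pos hypos i j) (by rw [sum_price hz', sum_price hy])
  have h3 : ∑ i, (∑ j, mix P x s i j * gradPhi a ρ y i j +
        (1 - ρ i) / ρ i * KL (mix P x s i) (y i)) +
      ∑ i, KL (mix P x s i) (y i) -
      ∑ i, (∑ j, mix P s x i j * gradPhi a ρ y i j +
        (1 - ρ i) / ρ i * KL (mix P s x i) (y i)) ≤
      ∑ i, (2 - σ i) * w i * KL (s i) (y i) - 2 * ∑ i, w i * KL (s i) (x i) := by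
    rw [Finset.mul_sum, ← Finset.sum_add_distrib, ← Finset.sum_sub_distrib,
      ← Finset.sum_sub_distrib]
    refine Finset.sum_le_sum fun i _ => ?_
    have hsum : ∑ j, s i j = ∑ j, x i j := by rw [(hs i).2, (hx i).2]
    have hxy : 0 ≤ KL (x i) (y i) :=
      KL_nonneg (hx i).1 (hypos i) (by rw [(hx i).2, (hy i).2])
    have hsy : 0 ≤ KL (s i) (y i) :=
      KL_nonneg (hs i).1 (hypos i) (by rw [(hs i).2, (hy i).2])
    have hr := hρ i
    have h4 := mul_nonneg (hw i).le hxy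
    have h5 := mul_le_mul_of_nonneg_right (hσ i) hsy
    by_cases hi : i ∈ P
    · obtain ⟨C, hC⟩ := hstepP i hi
      have key := mirror_step_inner (hs i).1 (hxpos i) (hypos i) hsum hC
      have hc : (1 - ρ i) / ρ i = w i - 1 := by rw [hwP i hi]; field_simp
      simp only [mix, if_pos hi, hc]
      linarith
    · obtain ⟨C, hC⟩ := hstepN i hi
      have key := mirror_step_inner (hs i).1 (hxpos i) (hypos i) hsum hC
      have hc : (1 - ρ i) / ρ i = -w i := by rw [hwN i hi]; field_simp; ring
      simp only [mul_neg, Finset.sum_neg_distrib] at key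
      simp only [mix, if_neg hi, hc]
      linarith
  linarith

theorem normalized_pos_and_sum {n : ℕ} {x r : Fin n → ℝ} {e : ℝ} (he : 0 < e)
    (hn : 0 < n) (hr : ∀ j, 0 < r j) (hx : ∀ j, x j = e * r j / ∑ k, r k) :
    (∀ j, 0 < x j) ∧ ∑ j, x j = e := by
  have hS : 0 < ∑ k, r k := Finset.sum_pos (fun k _ => hr k) ⟨⟨0, hn⟩, Finset.mem_univ _⟩
  refine ⟨fun j => ?_, ?_⟩
  · rw [hx j]
    exact div_pos (mul_pos he (hr j)) hS
  · simp_rw [hx]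
    rw [← Finset.sum_div, ← Finset.mul_sum, mul_div_cancel_right₀ _ hS.ne']

theorem log_normalized {n : ℕ} {x r : Fin n → ℝ} {e : ℝ} (he : 0 < e)
    (hr : ∀ j, 0 < r j) (hx : ∀ j, x j = e * r j ^ ((1 : ℝ) / 2) / ∑ k, r k ^ ((1 : ℝ) / 2))
    (j : Fin n) :
    Real.log (x j) = Real.log e - Real.log (∑ k, r k ^ ((1 : ℝ) / 2)) +
      1 / 2 * Real.log (r j) := by
  have hpos : ∀ k, 0 < r k ^ ((1 : ℝ) / 2) := fun k => Real.rpow_pos_of_pos (hr k) _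
  have hS : 0 < ∑ k, r k ^ ((1 : ℝ) / 2) :=
    Finset.sum_pos (fun k _ => hpos k) ⟨j, Finset.mem_univ _⟩
  rw [hx j, Real.log_div (mul_pos he (hpos j)).ne' hS.ne', Real.log_mul he.ne' (hpos j).ne',
    Real.log_rpow (hr j)]
  ring

/-- Linear convergence of the Damped Proportional Response when all
buyers have `ρ_i ∈ (-∞,0) ∪ (0,1)` (no linear, Leontief or Cobb-Douglas utilities),
with `σ_{>0} = min_{ρ_i>0} (1-ρ_i)` and `σ_{<0} = min_{ρ_i<0} 1/(1-ρ_i)`. -/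
theorem damped_proportional_response_linear {m n : ℕ}
    (P : Finset (Fin m))
    (e : Fin m → ℝ) (he : ∀ i, 0 < e i)
    (a : Fin m → Fin n → ℝ) (ha : ∀ i j, 0 < a i j)
    (ρ : Fin m → ℝ) (hρ : ∀ i, (0 < ρ i ∧ ρ i < 1) ∨ ρ i < 0)
    (hP : ∀ i, i ∈ P ↔ 0 < ρ i)
    (b : ℕ → Fin m → Fin n → ℝ)
    (hb0pos : ∀ i j, 0 < b 0 i j) (hb0 : Feasible e (b 0))
    -- the Damped Proportional Response update
    (hupdPos : ∀ t, ∀ i ∈ P, ∀ j, b (t + 1) i j =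
      e i * (b t i j * (a i j * (b t i j / price (b t) j) ^ ρ i)) ^ ((1 : ℝ) / 2) /
        ∑ k, (b t i k * (a i k * (b t i k / price (b t) k) ^ ρ i)) ^ ((1 : ℝ) / 2))
    (hupdNeg : ∀ t, ∀ i ∉ P, ∀ j, b (t + 1) i j =
      e i * (b t i j * (a i j / price (b t) j ^ ρ i) ^ (1 / (1 - ρ i))) ^ ((1 : ℝ) / 2) /
        ∑ k, (b t i k * (a i k / price (b t) k ^ ρ i) ^ (1 / (1 - ρ i))) ^ ((1 : ℝ) / 2))
    -- σ_{>0} = min_{i : ρ_i > 0} (1 - ρ_i)  and  σ_{<0} = min_{i : ρ_i < 0} 1/(1 - ρ_i)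
    (σpos σneg : ℝ)
    (hσposle : ∀ i ∈ P, σpos ≤ 1 - ρ i) (hσposmem : ∃ i ∈ P, σpos = 1 - ρ i)
    (hσnegle : ∀ i ∉ P, σneg ≤ 1 / (1 - ρ i)) (hσnegmem : ∃ i ∉ P, σneg = 1 / (1 - ρ i))
    -- (b*_{>0}, b*_{<0}) is the saddle point of Φ (the market equilibrium)
    (bstar : Fin m → Fin n → ℝ) (hbstarFeas : Feasible e bstar)
    (hbstarMin : ∀ b', Feasible e b' → Phi a ρ bstar ≤ Phi a ρ (mix P b' bstar))
    (hbstarMax : ∀ b', Feasible e b' → Phi a ρ (mix P bstar b') ≤ Phi a ρ bstar)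
    (T : ℕ) (hT : 1 ≤ T) :
    Phi a ρ (mix P (b T) bstar) - Phi a ρ (mix P bstar (b T)) ≤
      (1 - min σpos σneg / 2) ^ (T - 1) *
        ((∑ i ∈ Pᶜ, (2 - σneg) * ((ρ i - 1) / ρ i) * KL (bstar i) (b 0 i)) +
          ∑ i ∈ P, (2 - σpos) * (1 / ρ i) * KL (bstar i) (b 0 i)) := by
  have hρ0 : ∀ i, ρ i ≠ 0 := fun i => (hρ i).elim (fun h => h.1.ne') (fun h => h.ne)
  have hN : ∀ i ∉ P, ρ i < 0 := fun i hi =>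
    (hρ i).resolve_left fun h => hi ((hP i).2 h.1)
  have hlt : ∀ i, ρ i < 1 := fun i => (hρ i).elim And.right fun h => h.trans one_pos
  obtain ⟨i₀, hi₀, hσpos⟩ := hσposmem
  have hn : 0 < n := by
    rcases Nat.eq_zero_or_pos n with rfl | h
    · have h := (hb0 i₀).2
      simp only [Finset.univ_eq_empty, Finset.sum_empty] at h
      exact absurd h (he i₀).ne
    · exact h
  have hb : ∀ t, (∀ i j, 0 < b t i j) ∧ Feasible e (b t) := by
    intro t
    induction t with
    | zero => exact ⟨hb0pos, hb0⟩
    | succ t ih =>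
      have hrow : ∀ i, (∀ j, 0 < b (t + 1) i j) ∧ ∑ j, b (t + 1) i j = e i := by
        intro i
        by_cases hi : i ∈ P
        · refine normalized_pos_and_sum (he i) hn (fun j => ?_) (hupdPos t i hi)
          have h1 := ih.1 i j
          have h2 := price_pos ih.1 i j
          have h3 := ha i j
          positivity
        · refine normalized_pos_and_sum (he i) hn (fun j => ?_) (hupdNeg t i hi)
          have h1 := ih.1 i j
          have h2 := price_pos ih.1 i j
          have h3 := ha i j
          positivity
      exact ⟨fun i => (hrow i).1, fun i => ⟨fun j => ((hrow i).1 j).le, (hrow i).2⟩⟩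
  let w : Fin m → ℝ := fun i => if i ∈ P then 1 / ρ i else (ρ i - 1) / ρ i
  let σ : Fin m → ℝ := fun i => if i ∈ P then σpos else σneg
  have hwP : ∀ i ∈ P, w i = 1 / ρ i := fun i hi => if_pos hi
  have hwN : ∀ i ∉ P, w i = (ρ i - 1) / ρ i := fun i hi => if_neg hi
  have hσP : ∀ i ∈ P, σ i = σpos := fun i hi => if_pos hi
  have hσN : ∀ i ∉ P, σ i = σneg := fun i hi => if_neg hi
  have hw : ∀ i, 0 < w i := by
    intro i
    by_cases hi : i ∈ P
    · rw [hwP i hi]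
      exact one_div_pos.2 ((hP i).1 hi)
    · rw [hwN i hi]
      exact div_pos_of_neg_of_neg (sub_neg.2 (hlt i)) (hN i hi)
  have hσ : ∀ i, 1 ≤ (1 - σ i) * w i := by
    intro i
    by_cases hi : i ∈ P
    · have h := (hP i).1 hi
      rw [hwP i hi, hσP i hi, mul_one_div, one_le_div h]
      linarith [hσposle i hi]
    · have h := hN i hi
      have h1 := hσnegle i hi
      rw [le_div_iff₀ (sub_pos.2 (hlt i))] at h1
      rw [hwN i hi, hσN i hi, ← mul_div_assoc, one_le_div_of_neg h]
      linarith
  have hstep : ∀ t, Phi a ρ (mix P (b (t + 1)) bstar) - Phi a ρ (mix P bstar (b (t + 1))) ≤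
      ∑ i, (2 - σ i) * w i * KL (bstar i) (b t i) -
        2 * ∑ i, w i * KL (bstar i) (b (t + 1) i) := by
    intro t
    refine mirror_step_gap_le P ha hρ0 hwP hwN hw hσ (hb (t + 1)).1 (hb t).1 (hb (t + 1)).2
      (hb t).2 hbstarFeas (fun i hi => ?_) (fun i hi => ?_)
    · have hlog := log_normalized (he i) (fun j => by
        have h1 := (hb t).1 i j
        have h2 := price_pos (hb t).1 i j
        have h3 := ha i j
        positivity) (hupdPos t i hi)
      refine ⟨2 * w i * (Real.log (e i) - Real.log (∑ k, (b t i k * (a i k *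
        (b t i k / price (b t) k) ^ ρ i)) ^ ((1 : ℝ) / 2))), fun j => ?_⟩
      have h1 := (hb t).1 i j
      have h2 := price_pos (hb t).1 i j
      have h3 := ha i j
      have hr := hρ0 i
      rw [hlog j, Real.log_mul h1.ne' (by positivity), Real.log_mul h3.ne' (by positivity),
        Real.log_rpow (by positivity), Real.log_div h1.ne' h2.ne', hwP i hi]
      unfold gradPhi
      field_simp
      ring
    · have hlog := log_normalized (he i) (fun j => by
        have h1 := (hb t).1 i j
        have h2 := price_pos (hb t).1 i j
        have h3 := ha i j
        positivity) (hupdNeg t i hi)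
      refine ⟨2 * w i * (Real.log (e i) - Real.log (∑ k, (b t i k *
        (a i k / price (b t) k ^ ρ i) ^ (1 / (1 - ρ i))) ^ ((1 : ℝ) / 2))), fun j => ?_⟩
      have h1 := (hb t).1 i j
      have h2 := price_pos (hb t).1 i j
      have h3 := ha i j
      have hr := hρ0 i
      have hr1 : 1 - ρ i ≠ 0 := (sub_pos.2 (hlt i)).ne'
      rw [hlog j, Real.log_mul h1.ne' (by positivity), Real.log_rpow (by positivity),
        Real.log_div h3.ne' (by positivity), Real.log_rpow h2, hwN i hi]
      unfold gradPhi
      field_simp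
      ring
  have hgap : ∀ t, 0 ≤ Phi a ρ (mix P (b t) bstar) - Phi a ρ (mix P bstar (b t)) := fun t => by
    linarith [hbstarMin _ (hb t).2, hbstarMax _ (hb t).2]
  have hKL : ∀ t i, 0 ≤ w i * KL (bstar i) (b t i) := fun t i =>
    mul_nonneg (hw i).le (KL_nonneg (hbstarFeas i).1 ((hb t).1 i)
      (by rw [(hbstarFeas i).2, ((hb t).2 i).2]))
  have hr0 : 0 ≤ 1 - min σpos σneg / 2 := by
    have := min_le_left σpos σneg
    linarith [(hP i₀).1 hi₀]
  have hdecay : ∀ t, ∑ i, (2 - σ i) * w i * KL (bstar i) (b t i) ≤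
      (1 - min σpos σneg / 2) ^ t * ∑ i, (2 - σ i) * w i * KL (bstar i) (b 0 i) := by
    intro t
    induction t with
    | zero => simp
    | succ t ih =>
      calc ∑ i, (2 - σ i) * w i * KL (bstar i) (b (t + 1) i)
          ≤ (1 - min σpos σneg / 2) * (2 * ∑ i, w i * KL (bstar i) (b (t + 1) i)) := by
            rw [Finset.mul_sum, Finset.mul_sum]
            refine Finset.sum_le_sum fun i _ => ?_
            have hmin : min σpos σneg ≤ σ i := by
              by_cases hi : i ∈ P
              · rw [hσP i hi]
                exact min_le_left _ _
              · rw [hσN i hi]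
                exact min_le_right _ _
            nlinarith [mul_le_mul_of_nonneg_right hmin (hKL (t + 1) i)]
        _ ≤ (1 - min σpos σneg / 2) * ((1 - min σpos σneg / 2) ^ t *
              ∑ i, (2 - σ i) * w i * KL (bstar i) (b 0 i)) :=
            mul_le_mul_of_nonneg_left (by linarith [hstep t, hgap (t + 1)]) hr0
        _ = _ := by ring
  have hinit : ∑ i, (2 - σ i) * w i * KL (bstar i) (b 0 i) =
      (∑ i ∈ Pᶜ, (2 - σneg) * ((ρ i - 1) / ρ i) * KL (bstar i) (b 0 i)) +
        ∑ i ∈ P, (2 - σpos) * (1 / ρ i) * KL (bstar i) (b 0 i) := by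
    rw [← Finset.sum_compl_add_sum P]
    congr 1
    · refine Finset.sum_congr rfl fun i hi => ?_
      rw [hwN i (Finset.mem_compl.1 hi), hσN i (Finset.mem_compl.1 hi)]
    · refine Finset.sum_congr rfl fun i hi => ?_
      rw [hwP i hi, hσP i hi]
  obtain ⟨k, rfl⟩ := Nat.exists_eq_add_of_le' hT
  rw [← hinit, Nat.add_sub_cancel]
  have hfin := Finset.sum_nonneg fun i (_ : i ∈ Finset.univ) => hKL (k + 1) i
  linarith [hstep k, hdecay k]
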